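/- Lemma D.1 (decoupling/Sudakov–Fernique step of the moment bound): let {x_t}_{t=1}^n be an ℍ-valued centered stationary Gaussian process whose cross-covariance operators Σ_h are trace class for all h ∈ ℤ. Then 𝔼[‖Σ̂₀ − Σ₀‖] ≤ (2√2/n)·𝔼[‖X‖_HS]·( √(tr(Σ̄_n)) + √(‖Σ̄_n‖) ), where ‖X‖_HS = √(Σ_{t=1}^n ‖x_t‖²). -/

import Mathlib

open MeasureTheory ProbabilityTheory
open scoped ENNReal NNReal BigOperators RealInnerProductSpace

noncomputable section

namespace TS

variable {H : Type*} [NormedAddCommGroup H] [InnerProductSpace ℝ H] [CompleteSpace H]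

/-- Operator norm of a (not necessarily linear, in general the difference of two
covariance operators) map `T : H → H`: `sup_{‖u‖ = 1} ‖T u‖`. -/
def opNormH (T : H → H) : ℝ := sSup {r | ∃ u : H, ‖u‖ = 1 ∧ r = ‖T u‖}

/-- A centered (jointly) Gaussian `H`-valued process: every finite linear functional
combination of the `x_t` is a centered real Gaussian. -/
def IsCenteredGaussianProcess {Ω : Type*} [MeasureSpace Ω] (x : ℤ → Ω → H) : Prop :=
  ∀ (m : ℕ) (ts : Fin m → ℤ) (us : Fin m → H),
    ∃ v : ℝ≥0,
      Measure.map (fun ω => ∑ j, ⟪us j, x (ts j) ω⟫) ℙ = gaussianReal 0 v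

/-- (Covariance) stationarity of a centered Gaussian process. -/
def IsCovStationary {Ω : Type*} [MeasureSpace Ω] (x : ℤ → Ω → H) : Prop :=
  ∀ (t h : ℤ) (u v : H),
    (∫ ω, ⟪x (t + h) ω, u⟫ * ⟪x t ω, v⟫) = ∫ ω, ⟪x h ω, u⟫ * ⟪x 0 ω, v⟫

/-- The covariance operator `Σ₀`, given through the singular value data
`Σ_h u = Σ_i σ_i(Σ_h) ⟨f_{h,i}, u⟩ g_{h,i}` at `h = 0`. -/
def Sig0Fun (σ : ℤ → ℕ → ℝ) (f g : ℤ → ℕ → H) (u : H) : H :=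
  ∑' i, (σ 0 i * ⟪f 0 i, u⟫) • g 0 i

/-- The symmetrized positive part
`Σ̃_h u = (1/2) Σ_i σ_i(Σ_h)(⟨f_{h,i},u⟩ f_{h,i} + ⟨g_{h,i},u⟩ g_{h,i})`. -/
def SigTildeFun (σ : ℤ → ℕ → ℝ) (f g : ℤ → ℕ → H) (h : ℤ) (u : H) : H :=
  (1 / 2 : ℝ) • ∑' i, σ h i • ((⟪f h i, u⟫) • f h i + (⟪g h i, u⟫) • g h i)

/-- The integrated covariance `Σ̄_n u = Σ₀ u + 2 Σ_{h=1}^{n-1} Σ̃_h u`. -/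
def SigBarFun (σ : ℤ → ℕ → ℝ) (f g : ℤ → ℕ → H) (n : ℕ) (u : H) : H :=
  Sig0Fun σ f g u + (2 : ℝ) • ∑ h ∈ Finset.Ico 1 n, SigTildeFun σ f g (h : ℤ) u

/-- The empirical covariance operator `Σ̂₀ u = (1/n) Σ_{t=1}^n ⟨x_t, u⟩ x_t`. -/
def hatSigFun {Ω : Type*} (n : ℕ) (x : ℤ → Ω → H) (ω : Ω) (u : H) : H :=
  (1 / (n : ℝ)) • ∑ t ∈ Finset.Icc (1 : ℤ) (n : ℤ), (⟪x t ω, u⟫) • x t ω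

/-- `tr(Σ₀) = Σ_i σ_i(Σ₀)`. -/
def trSig0 (σ : ℤ → ℕ → ℝ) : ℝ := ∑' i, σ 0 i

/-- `tr(Σ̄_n) = tr(Σ₀) + 2 Σ_{h=1}^{n-1} tr(Σ̃_h)`, with `tr(Σ̃_h) = Σ_i σ_i(Σ_h)`. -/
def trSigBar (σ : ℤ → ℕ → ℝ) (n : ℕ) : ℝ :=
  trSig0 σ + 2 * ∑ h ∈ Finset.Ico 1 n, ∑' i, σ (h : ℤ) i

/-- The Hilbert–Schmidt norm `‖X‖_HS = √(Σ_{t=1}^n ‖x_t‖²)` of the sample. -/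
def hsNorm {Ω : Type*} (n : ℕ) (x : ℤ → Ω → H) (ω : Ω) : ℝ :=
  Real.sqrt (∑ t ∈ Finset.Icc (1 : ℤ) (n : ℤ), ‖x t ω‖ ^ 2)

end TS

open TS
open scoped RealInnerProductSpace


/-- One integration-by-differentiation step for the moments of a centered real Gaussian. -/
lemma integral_pow_succ_mul_exp_gaussianReal (v : ℝ≥0) (k : ℕ) (p : ℝ → ℝ) (p' : ℝ → ℝ)
    (hp : ∀ t, HasDerivAt p (p' t) t)
    (h : ∀ t, ∫ y, y ^ k * Real.exp (t * y) ∂(gaussianReal 0 v) = p t * Real.exp (v * t ^ 2 / 2))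
    (t : ℝ) :
    ∫ y, y ^ (k + 1) * Real.exp (t * y) ∂(gaussianReal 0 v) =
      (p' t + v * t * p t) * Real.exp (v * t ^ 2 / 2) := by
  have h1 := hasDerivAt_integral_pow_mul_exp_real (X := id) (μ := gaussianReal 0 v) (t := t)
    (by rw [integrableExpSet_id_gaussianReal]; simp) k
  have h2 : HasDerivAt (fun t => p t * Real.exp (v * t ^ 2 / 2))
      ((p' t + v * t * p t) * Real.exp (v * t ^ 2 / 2)) t := by
    have h3 : HasDerivAt (fun t : ℝ => (v : ℝ) * t ^ 2 / 2) (v * t) t := by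
      have := (((hasDerivAt_id t).pow 2).const_mul (v : ℝ)).div_const 2
      convert! this using 1
      simp; ring
    convert! (hp t).mul h3.exp using 1
    ring
  have h4 : (fun t => ∫ y, (id y) ^ k * Real.exp (t * id y) ∂(gaussianReal 0 v)) =
      fun t => p t * Real.exp (v * t ^ 2 / 2) := funext h
  rw [h4] at h1
  exact h1.unique h2

lemma integral_sq_gaussianReal_zero (v : ℝ≥0) : ∫ y, y ^ 2 ∂(gaussianReal 0 v) = v := by
  have h := variance_id_gaussianReal (μ := 0) (v := v)
  rw [variance_of_integral_eq_zero aemeasurable_id (by simp)] at h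
  simpa using h

lemma integral_pow_four_gaussianReal_zero (v : ℝ≥0) :
    ∫ y, y ^ 4 ∂(gaussianReal 0 v) = 3 * (v : ℝ) ^ 2 := by
  have h0 : ∀ t, ∫ y, y ^ 0 * Real.exp (t * y) ∂(gaussianReal 0 v) =
      1 * Real.exp (v * t ^ 2 / 2) := by
    intro t
    have := congrFun (mgf_id_gaussianReal (μ := 0) (v := v)) t
    simpa [mgf] using this
  have h1 := integral_pow_succ_mul_exp_gaussianReal v 0 (fun _ => 1) (fun _ => 0)
    (fun t => hasDerivAt_const t 1) h0
  have h2 := integral_pow_succ_mul_exp_gaussianReal v 1 (fun t => 0 + v * t * 1) (fun _ => v)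
    (fun t => by simpa using (hasDerivAt_id t).const_mul (v : ℝ)) h1
  have h3 := integral_pow_succ_mul_exp_gaussianReal v 2 (fun t => v + v * t * (0 + v * t * 1))
    (fun t => 2 * v ^ 2 * t) (fun t => by
      have := (((hasDerivAt_id t).pow 2).const_mul ((v : ℝ) ^ 2)).const_add (v : ℝ)
      convert! this using 1
      · funext s; simp; ring
      · simp; ring) h2
  have h4 := integral_pow_succ_mul_exp_gaussianReal v 3
    (fun t => 2 * v ^ 2 * t + v * t * (v + v * t * (0 + v * t * 1)))
    (fun t => 3 * v ^ 2 + 3 * v ^ 3 * t ^ 2) (fun t => by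
      have := ((hasDerivAt_id t).const_mul (3 * (v : ℝ) ^ 2)).add
        (((hasDerivAt_id t).pow 3).const_mul ((v : ℝ) ^ 3))
      convert! this using 1
      · funext s; simp; ring
      · simp; ring) h3 0
  simpa using h4

section FourthMoments

variable {Ω : Type*} [MeasurableSpace Ω] {μ : Measure Ω}

/-- `y` is a centered Gaussian vector: all linear combinations of its coordinates are centered
Gaussian real random variables. -/
def IsCenteredGaussianVec (μ : Measure Ω) {m : ℕ} (y : Fin m → Ω → ℝ) : Prop :=
  ∀ c : Fin m → ℝ, ∃ v : ℝ≥0, Measure.map (fun ω => ∑ j, c j * y j ω) μ = gaussianReal 0 v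

lemma aemeasurable_of_map_eq_gaussianReal {X : Ω → ℝ} {v : ℝ≥0}
    (h : Measure.map X μ = gaussianReal 0 v) : AEMeasurable X μ := by
  apply AEMeasurable.of_map_ne_zero
  rw [h]
  exact IsProbabilityMeasure.ne_zero _

lemma memLp_of_map_eq_gaussianReal {X : Ω → ℝ} {v : ℝ≥0}
    (h : Measure.map X μ = gaussianReal 0 v) {p : ℝ≥0∞} (hp : p ≠ ∞) : MemLp X p μ := by
  have h1 := memLp_id_gaussianReal' (μ := 0) (v := v) p hp
  rw [← h, memLp_map_measure_iff aestronglyMeasurable_id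
    (aemeasurable_of_map_eq_gaussianReal h)] at h1
  exact h1

lemma integral_pow_four_of_map_eq_gaussianReal {X : Ω → ℝ} {v : ℝ≥0}
    (h : Measure.map X μ = gaussianReal 0 v) :
    ∫ ω, X ω ^ 4 ∂μ = 3 * (∫ ω, X ω ^ 2 ∂μ) ^ 2 := by
  have hX := aemeasurable_of_map_eq_gaussianReal h
  have h4 := integral_map (f := fun y : ℝ => y ^ 4) hX
    (by fun_prop)
  have h2 := integral_map (f := fun y : ℝ => y ^ 2) hX
    (by fun_prop)
  rw [← h4, ← h2, h, integral_pow_four_gaussianReal_zero, integral_sq_gaussianReal_zero]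

/-- The product of four `L⁴` functions is integrable. -/
lemma integrable_mul_four {a b c d : Ω → ℝ} (ha : MemLp a 4 μ) (hb : MemLp b 4 μ)
    (hc : MemLp c 4 μ) (hd : MemLp d 4 μ) :
    Integrable (fun ω => a ω * b ω * c ω * d ω) μ := by
  have : ENNReal.HolderTriple 4 4 2 := ⟨by
    rw [← two_mul, show (4 : ℝ≥0∞) = 2 * 2 by norm_num,
      ENNReal.mul_inv (by simp) (by simp), ← mul_assoc, ENNReal.mul_inv_cancel (by simp) (by simp),
      one_mul]⟩
  have h1 : MemLp (fun ω => a ω * b ω) 2 μ := hb.mul ha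
  have h2 : MemLp (fun ω => c ω * d ω) 2 μ := hd.mul hc
  have h3 := h1.integrable_mul h2
  refine h3.congr (Filter.Eventually.of_forall fun ω => ?_)
  simp [mul_assoc]

/-- **Isserlis' theorem** for four jointly centered Gaussian variables. -/
lemma IsCenteredGaussianVec.integral_mul_four [IsFiniteMeasure μ] {y : Fin 4 → Ω → ℝ}
    (hy : IsCenteredGaussianVec μ y) :
    ∫ ω, y 0 ω * y 1 ω * y 2 ω * y 3 ω ∂μ =
      (∫ ω, y 0 ω * y 1 ω ∂μ) * (∫ ω, y 2 ω * y 3 ω ∂μ) +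
      (∫ ω, y 0 ω * y 2 ω ∂μ) * (∫ ω, y 1 ω * y 3 ω ∂μ) +
      (∫ ω, y 0 ω * y 3 ω ∂μ) * (∫ ω, y 1 ω * y 2 ω ∂μ) := by
  have hL : ∀ i, MemLp (y i) 4 μ := by
    intro i
    obtain ⟨v, hv⟩ := hy (Pi.single i 1)
    have : (fun ω => ∑ j, (Pi.single i 1 : Fin 4 → ℝ) j * y j ω) = y i := by
      funext ω; simp [Pi.single_apply]
    rw [this] at hv
    exact memLp_of_map_eq_gaussianReal hv (p := 4) (by simp)
  have hL2 : ∀ i, MemLp (y i) 2 μ := fun i => (hL i).mono_exponent (by norm_num)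
  have hP : ∀ i j, Integrable (fun ω => y i ω * y j ω) μ := fun i j =>
    (hL2 i).integrable_mul (hL2 j)
  set Q : Fin 4 → Fin 4 → ℝ := fun i j => ∫ ω, y i ω * y j ω ∂μ with hQ
  have hsymm : ∀ i j, Q i j = Q j i := fun i j => by
    simp only [hQ]; congr 1; funext ω; ring
  have hsq : ∀ c : Fin 4 → ℝ,
      ∫ ω, (∑ j, c j * y j ω) ^ 2 ∂μ = ∑ i, ∑ j, c i * c j * Q i j := by
    intro c
    have : ∀ ω, (∑ j, c j * y j ω) ^ 2 = ∑ i, ∑ j, c i * c j * (y i ω * y j ω) := by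
      intro ω
      rw [sq, Finset.sum_mul_sum]
      refine Finset.sum_congr rfl fun i _ => Finset.sum_congr rfl fun j _ => by ring
    simp_rw [this]
    rw [integral_finsetSum _ fun i _ => integrable_finsetSum _ fun j _ => (hP i j).const_mul _]
    refine Finset.sum_congr rfl fun i _ => ?_
    rw [integral_finsetSum _ fun j _ => (hP i j).const_mul _]
    exact Finset.sum_congr rfl fun j _ => integral_const_mul _ _
  have h4 : ∀ c : Fin 4 → ℝ, ∫ ω, (∑ j, c j * y j ω) ^ 4 ∂μ =
      3 * (∑ i, ∑ j, c i * c j * Q i j) ^ 2 := by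
    intro c
    obtain ⟨v, hv⟩ := hy c
    rw [integral_pow_four_of_map_eq_gaussianReal hv, hsq]
  have hI4 : ∀ c : Fin 4 → ℝ, Integrable (fun ω => (∑ j, c j * y j ω) ^ 4) μ := by
    intro c
    obtain ⟨v, hv⟩ := hy c
    have h := memLp_of_map_eq_gaussianReal hv (p := 4) (by simp)
    refine (integrable_mul_four h h h h).congr (Filter.Eventually.of_forall fun ω => ?_)
    simp only; ring
  have key : ∀ ω, 192 * (y 0 ω * y 1 ω * y 2 ω * y 3 ω) =
      (∑ j, (![1, 1, 1, 1] : Fin 4 → ℝ) j * y j ω) ^ 4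
      - (∑ j, (![1, 1, 1, -1] : Fin 4 → ℝ) j * y j ω) ^ 4
      - (∑ j, (![1, 1, -1, 1] : Fin 4 → ℝ) j * y j ω) ^ 4
      + (∑ j, (![1, 1, -1, -1] : Fin 4 → ℝ) j * y j ω) ^ 4
      - (∑ j, (![1, -1, 1, 1] : Fin 4 → ℝ) j * y j ω) ^ 4
      + (∑ j, (![1, -1, 1, -1] : Fin 4 → ℝ) j * y j ω) ^ 4
      + (∑ j, (![1, -1, -1, 1] : Fin 4 → ℝ) j * y j ω) ^ 4
      - (∑ j, (![1, -1, -1, -1] : Fin 4 → ℝ) j * y j ω) ^ 4 := by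
    intro ω
    simp only [Fin.sum_univ_four, Matrix.cons_val]
    ring
  have hmain : 192 * ∫ ω, y 0 ω * y 1 ω * y 2 ω * y 3 ω ∂μ =
      192 * (Q 0 1 * Q 2 3 + Q 0 2 * Q 1 3 + Q 0 3 * Q 1 2) := by
    rw [← integral_const_mul]
    simp_rw [key]
    rw [integral_sub, integral_add, integral_add, integral_sub, integral_add, integral_sub,
      integral_sub]
    · rw [h4, h4, h4, h4, h4, h4, h4, h4]
      simp only [Fin.sum_univ_four, Matrix.cons_val]
      rw [hsymm 1 0, hsymm 2 0, hsymm 3 0, hsymm 2 1, hsymm 3 1, hsymm 3 2]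
      ring
    all_goals fun_prop
  exact mul_left_cancel₀ (by norm_num) hmain

end FourthMoments

section HilbertBasis

variable {H : Type*} [NormedAddCommGroup H] [InnerProductSpace ℝ H]

/-- An orthonormal family in a separable space is countable. -/
lemma Orthonormal.countable_of_separableSpace [TopologicalSpace.SeparableSpace H] {ι : Type*}
    {b : ι → H} (hb : Orthonormal ℝ b) : Countable ι := by
  have h : Pairwise (Function.onFun Disjoint fun i => Metric.ball (b i) (1 / 2)) := by
    intro i j hij
    refine Metric.ball_disjoint_ball ?_
    have h2 : ‖b i - b j‖ ^ 2 = 2 := by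
      rw [norm_sub_sq_real, hb.1, hb.1, hb.2 hij]
      norm_num
    rw [dist_eq_norm]
    nlinarith [norm_nonneg (b i - b j)]
  exact Pairwise.countable_of_isOpen_disjoint h (fun _ => Metric.isOpen_ball)
    (fun _ => Metric.nonempty_ball.2 (by norm_num))

variable {ι : Type*} (b : HilbertBasis ι ℝ H)

/-- Parseval's identity in `ℝ≥0∞`. -/
lemma HilbertBasis.tsum_ofReal_inner_sq (u : H) :
    ∑' k, ENNReal.ofReal (⟪u, b k⟫ ^ 2) = ENNReal.ofReal (‖u‖ ^ 2) := by
  have h := b.hasSum_inner_mul_inner u u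
  have h' : (fun k => ⟪u, b k⟫ * ⟪b k, u⟫) = fun k => ⟪u, b k⟫ ^ 2 := by
    funext k; rw [real_inner_comm u (b k)]; ring
  rw [h', real_inner_self_eq_norm_sq] at h
  rw [← h.tsum_eq, ENNReal.ofReal_tsum_of_nonneg (fun _ => sq_nonneg _) h.summable]

/-- The operator norm is at most the Hilbert–Schmidt norm, for a symmetric map. -/
lemma HilbertBasis.ofReal_norm_sq_le_of_symmetric {D : H → H}
    (hD : ∀ u v, ⟪D u, v⟫ = ⟪u, D v⟫) (u : H) (hu : ‖u‖ = 1) :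
    ENNReal.ofReal (‖D u‖ ^ 2) ≤ ∑' k, ∑' l, ENNReal.ofReal (⟪D (b k), b l⟫ ^ 2) := by
  rw [← b.tsum_ofReal_inner_sq]
  refine ENNReal.tsum_le_tsum fun k => ?_
  rw [b.tsum_ofReal_inner_sq, hD]
  refine ENNReal.ofReal_le_ofReal ?_
  have h := abs_real_inner_le_norm u (D (b k))
  rw [hu, one_mul] at h
  exact sq_le_sq' (by linarith [neg_abs_le ⟪u, D (b k)⟫]) (le_trans (le_abs_self _) h)

end HilbertBasis

section RealIntegrals

variable {Ω : Type*} [MeasurableSpace Ω] {μ : Measure Ω} [IsProbabilityMeasure μ]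

/-- A nonnegative variable whose second moment is dominated by `B` has mean at most `√B`. -/
lemma integral_le_sqrt_of_ofReal_sq_le {φ : Ω → ℝ} {Q : Ω → ℝ≥0∞} {B : ℝ}
    (hφ : ∀ ω, 0 ≤ φ ω) (hφQ : ∀ ω, ENNReal.ofReal (φ ω ^ 2) ≤ Q ω) (hQ : AEMeasurable Q μ)
    (hB : ∫⁻ ω, Q ω ∂μ ≤ ENNReal.ofReal B) : ∫ ω, φ ω ∂μ ≤ √B := by
  have hfin : ∫⁻ ω, Q ω ∂μ ≠ ∞ := ne_top_of_le_ne_top ENNReal.ofReal_ne_top hB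
  have hint : Integrable (fun ω => (Q ω).toReal) μ := integrable_toReal_of_lintegral_ne_top hQ hfin
  have hQint : ∫ ω, (Q ω).toReal ∂μ ≤ √B ^ 2 := by
    rw [integral_toReal hQ (ae_lt_top' hQ hfin)]
    refine ENNReal.toReal_le_of_le_ofReal (sq_nonneg _) (hB.trans (ENNReal.ofReal_le_ofReal ?_))
    rcases le_total 0 B with h | h
    · rw [Real.sq_sqrt h]
    · exact h.trans (sq_nonneg _)
  refine le_of_forall_pos_le_add fun ε hε => ?_
  set a := √B + ε with ha
  have ha0 : 0 < a := by positivity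
  have hle : ∫ ω, φ ω ∂μ ≤ ∫ ω, ((Q ω).toReal / (2 * a) + a / 2) ∂μ := by
    refine integral_mono_of_nonneg (Filter.Eventually.of_forall hφ)
      ((hint.div_const _).add (integrable_const _)) ?_
    filter_upwards [ae_lt_top' hQ hfin] with ω hω
    have h1 : φ ω ^ 2 ≤ (Q ω).toReal := (ENNReal.ofReal_le_iff_le_toReal hω.ne).1 (hφQ ω)
    have h2 : φ ω ≤ φ ω ^ 2 / (2 * a) + a / 2 := by
      rw [div_add_div _ _ (by positivity) (by positivity), le_div_iff₀ (by positivity)]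
      nlinarith [sq_nonneg (φ ω - a)]
    refine h2.trans ?_
    gcongr
  refine hle.trans ?_
  rw [integral_add (hint.div_const _) (integrable_const _), integral_div, integral_const,
    probReal_univ, one_smul]
  have h3 : (∫ ω, (Q ω).toReal ∂μ) / (2 * a) ≤ a / 2 := by
    rw [div_le_div_iff₀ (by positivity) (by positivity)]
    have : √B ^ 2 ≤ a ^ 2 := by gcongr; linarith
    nlinarith
  linarith

/-- A lower bound on the mean of `√R` when the second moment of `R` is at most `3 (𝔼 R)²`. -/
lemma sqrt_le_two_mul_integral_sqrt {R : Ω → ℝ} {m : ℝ} (hm : 0 ≤ m) (hR0 : ∀ ω, 0 ≤ R ω)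
    (hR : AEMeasurable R μ) (h1 : ∫⁻ ω, ENNReal.ofReal (R ω) ∂μ = ENNReal.ofReal m)
    (h2 : ∫⁻ ω, ENNReal.ofReal (R ω ^ 2) ∂μ ≤ ENNReal.ofReal (3 * m ^ 2)) :
    √m ≤ 2 * ∫ ω, √(R ω) ∂μ := by
  rcases hm.eq_or_lt with rfl | hm
  · simpa using integral_nonneg fun ω => Real.sqrt_nonneg (R ω)
  have i1 : Integrable R μ := by
    refine ⟨hR.aestronglyMeasurable, ?_⟩
    rw [hasFiniteIntegral_iff_ofReal (Filter.Eventually.of_forall hR0), h1]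
    exact ENNReal.ofReal_lt_top
  have i2 : Integrable (fun ω => R ω ^ 2) μ := by
    refine ⟨(hR.pow_const 2).aestronglyMeasurable, ?_⟩
    rw [hasFiniteIntegral_iff_ofReal (Filter.Eventually.of_forall fun ω => sq_nonneg _)]
    exact h2.trans_lt ENNReal.ofReal_lt_top
  have e1 : ∫ ω, R ω ∂μ = m := by
    rw [integral_eq_lintegral_of_nonneg_ae (Filter.Eventually.of_forall hR0)
      hR.aestronglyMeasurable, h1, ENNReal.toReal_ofReal hm.le]
  have e2 : ∫ ω, R ω ^ 2 ∂μ ≤ 3 * m ^ 2 := by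
    rw [integral_eq_lintegral_of_nonneg_ae (Filter.Eventually.of_forall fun ω => sq_nonneg _)
      (hR.pow_const 2).aestronglyMeasurable]
    exact ENNReal.toReal_le_of_le_ofReal (by positivity) h2
  have i0 : Integrable (fun ω => √(R ω)) μ := by
    refine Integrable.mono' (i1.add (integrable_const 1)) hR.sqrt.aestronglyMeasurable
      (Filter.Eventually.of_forall fun ω => ?_)
    rw [Real.norm_of_nonneg (Real.sqrt_nonneg _)]
    simp only [Pi.add_apply]
    nlinarith [Real.sq_sqrt (hR0 ω), sq_nonneg (√(R ω) - 1), Real.sqrt_nonneg (R ω)]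
  set r := √m with hr
  have hr0 : 0 < r := Real.sqrt_pos.2 hm
  have hrm : r ^ 2 = m := Real.sq_sqrt hm.le
  have hle : ∫ ω, (R ω / r - R ω ^ 2 * (4 / (27 * r ^ 3))) ∂μ ≤ ∫ ω, √(R ω) ∂μ := by
    refine integral_mono ((i1.div_const _).sub (i2.mul_const _)) i0 fun ω => ?_
    have hs := Real.sq_sqrt (hR0 ω)
    have hs0 := Real.sqrt_nonneg (R ω)
    set s := √(R ω)
    simp only
    rw [← hs]
    have : s - (s ^ 2 / r - (s ^ 2) ^ 2 * (4 / (27 * r ^ 3))) =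
        s * ((2 * s - 3 * r) ^ 2 * (s + 3 * r)) / (27 * r ^ 3) := by
      field_simp
      ring
    have h0 : 0 ≤ s * ((2 * s - 3 * r) ^ 2 * (s + 3 * r)) / (27 * r ^ 3) := by positivity
    linarith
  rw [integral_sub (i1.div_const _) (i2.mul_const _), integral_div, integral_mul_const, e1] at hle
  have h5 : (∫ ω, R ω ^ 2 ∂μ) * (4 / (27 * r ^ 3)) ≤ 3 * m ^ 2 * (4 / (27 * r ^ 3)) := by gcongr
  have h6 : m / r = r := by rw [← hrm]; field_simp
  have h7 : 3 * m ^ 2 * (4 / (27 * r ^ 3)) = 4 / 9 * r := by rw [← hrm]; field_simp; norm_num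
  linarith

end RealIntegrals

/-- Each row of the array `(|s - t|)` meets the value `0` once and any other value at most
twice. -/
lemma sum_natAbs_sub_le {S : ℕ → ℝ} (hS : ∀ h, 0 ≤ S h) (n : ℕ) {s : ℤ}
    (hs : s ∈ Finset.Icc (1 : ℤ) n) :
    ∑ t ∈ Finset.Icc (1 : ℤ) n, S (s - t).natAbs ≤ S 0 + 2 * ∑ h ∈ Finset.Ico 1 n, S h := by
  rw [Finset.mem_Icc] at hs
  have hinj : ∀ P : Finset ℤ, P ⊆ Finset.Icc (1 : ℤ) n → (∀ t ∈ P, t ≠ s) →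
      (Set.InjOn (fun t : ℤ => (s - t).natAbs) P) →
      ∑ t ∈ P, S (s - t).natAbs ≤ ∑ h ∈ Finset.Ico 1 n, S h := by
    intro P hP hne hi
    rw [← Finset.sum_image (f := S) hi]
    refine Finset.sum_le_sum_of_subset_of_nonneg ?_ fun h _ _ => hS h
    intro h hh
    obtain ⟨t, ht, rfl⟩ := Finset.mem_image.1 hh
    have h1 := Finset.mem_Icc.1 (hP ht)
    have h2 := hne t ht
    simp only [Finset.mem_Ico]
    omega
  rw [← Finset.sum_filter_add_sum_filter_not (Finset.Icc (1 : ℤ) n) (fun t => t < s),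
    ← Finset.sum_filter_add_sum_filter_not
      (Finset.filter (fun t => ¬ t < s) (Finset.Icc (1 : ℤ) n)) (fun t => s < t)]
  have h1 := hinj (Finset.filter (fun t => t < s) (Finset.Icc (1 : ℤ) n))
    (Finset.filter_subset _ _) (fun t ht => by simp at ht; omega)
    (fun a ha c hc hac => by simp at ha hc hac; omega)
  have h2 := hinj (Finset.filter (fun t => s < t)
      (Finset.filter (fun t => ¬ t < s) (Finset.Icc (1 : ℤ) n)))
    ((Finset.filter_subset _ _).trans (Finset.filter_subset _ _))
    (fun t ht => by simp at ht; omega)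
    (fun a ha c hc hac => by simp at ha hc hac; omega)
  have h3 : Finset.filter (fun t => ¬ s < t)
      (Finset.filter (fun t => ¬ t < s) (Finset.Icc (1 : ℤ) n)) = {s} := by
    ext t
    simp only [Finset.mem_filter, Finset.mem_Icc, Finset.mem_singleton]
    omega
  rw [h3, Finset.sum_singleton, sub_self, Int.natAbs_zero]
  linarith

lemma two_mul_mul_mul_le_of_sq_le {a c d : ℝ} (hc : 0 ≤ c) (hd : 0 ≤ d) (h : a ^ 2 ≤ c * d)
    (p q : ℝ) : 2 * a * p * q ≤ c * p ^ 2 + d * q ^ 2 := by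
  refine (abs_le_of_sq_le_sq' ?_ (by positivity)).2
  have h1 : (2 * a * p * q) ^ 2 ≤ 4 * (c * d) * (p ^ 2 * q ^ 2) := by
    calc (2 * a * p * q) ^ 2 = 4 * a ^ 2 * (p ^ 2 * q ^ 2) := by ring
      _ ≤ _ := by gcongr
  nlinarith [sq_nonneg (c * p ^ 2 - d * q ^ 2)]

section GaussianProcess

variable {H : Type*} [NormedAddCommGroup H] [InnerProductSpace ℝ H]
variable {Ω : Type*} [MeasureSpace Ω] {x : ℤ → Ω → H}

/-- The cross-covariance form `𝔼[⟨x_s, u⟩⟨x_t, v⟩]`. -/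
def crossCov (x : ℤ → Ω → H) (s t : ℤ) (u v : H) : ℝ := ∫ ω, ⟪x s ω, u⟫ * ⟪x t ω, v⟫

lemma crossCov_comm (s t : ℤ) (u v : H) : crossCov x s t u v = crossCov x t s v u := by
  simp only [crossCov, mul_comm]

lemma crossCov_self_nonneg (t : ℤ) (u : H) : 0 ≤ crossCov x t t u u :=
  integral_nonneg fun _ => mul_self_nonneg _

lemma TS.IsCovStationary.crossCov_self [CompleteSpace H] (hstat : IsCovStationary x) (t : ℤ)
    (u v : H) : crossCov x t t u v = crossCov x 0 0 u v := by
  simpa [crossCov] using hstat t 0 u v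

lemma TS.IsCenteredGaussianProcess.isCenteredGaussianVec [CompleteSpace H]
    (hx : IsCenteredGaussianProcess x) {m : ℕ} (ts : Fin m → ℤ) (us : Fin m → H) :
    IsCenteredGaussianVec ℙ (fun j ω => ⟪x (ts j) ω, us j⟫) := by
  intro c
  obtain ⟨v, hv⟩ := hx m ts (fun j => c j • us j)
  refine ⟨v, ?_⟩
  rw [← hv]
  congr 1
  funext ω
  refine Finset.sum_congr rfl fun j _ => ?_
  rw [real_inner_smul_left, real_inner_comm]

lemma TS.IsCenteredGaussianProcess.memLp_inner [CompleteSpace H]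
    (hx : IsCenteredGaussianProcess x) (t : ℤ) (u : H) {p : ℝ≥0∞} (hp : p ≠ ∞) :
    MemLp (fun ω => ⟪x t ω, u⟫) p ℙ := by
  obtain ⟨v, hv⟩ := hx.isCenteredGaussianVec (m := 1) (fun _ => t) (fun _ => u) (fun _ => 1)
  exact memLp_of_map_eq_gaussianReal (by simpa using hv) hp

lemma TS.IsCenteredGaussianProcess.integrable_mul_four [CompleteSpace H]
    (hx : IsCenteredGaussianProcess x) (s t : ℤ) (u v u' v' : H) :
    Integrable (fun ω => ⟪x s ω, u⟫ * ⟪x s ω, v⟫ * ⟪x t ω, u'⟫ * ⟪x t ω, v'⟫) :=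
  _root_.integrable_mul_four (hx.memLp_inner s u (p := 4) (by simp)) (hx.memLp_inner s v (p := 4) (by simp))
    (hx.memLp_inner t u' (p := 4) (by simp)) (hx.memLp_inner t v' (p := 4) (by simp))

lemma TS.IsCenteredGaussianProcess.integrable_mul [CompleteSpace H]
    (hx : IsCenteredGaussianProcess x) (s t : ℤ) (u v : H) :
    Integrable (fun ω => ⟪x s ω, u⟫ * ⟪x t ω, v⟫) :=
  MemLp.integrable_mul (hx.memLp_inner s u (p := 2) (by simp)) (hx.memLp_inner t v (p := 2) (by simp))

lemma TS.IsCenteredGaussianProcess.integral_mul_four [CompleteSpace H]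
    [IsProbabilityMeasure (ℙ : Measure Ω)]
    (hx : IsCenteredGaussianProcess x) (s t : ℤ) (u v u' v' : H) :
    ∫ ω, ⟪x s ω, u⟫ * ⟪x s ω, v⟫ * ⟪x t ω, u'⟫ * ⟪x t ω, v'⟫ =
      crossCov x s s u v * crossCov x t t u' v' + crossCov x s t u u' * crossCov x s t v v'
        + crossCov x s t u v' * crossCov x s t v u' := by
  have h := (hx.isCenteredGaussianVec ![s, s, t, t] ![u, v, u', v']).integral_mul_four
  simpa [crossCov] using h

/-- Cauchy–Schwarz for the cross-covariance form. -/
lemma TS.IsCenteredGaussianProcess.crossCov_sq_le [CompleteSpace H]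
    (hx : IsCenteredGaussianProcess x) (s t : ℤ) (u v : H) :
    crossCov x s t u v ^ 2 ≤ crossCov x s s u u * crossCov x t t v v := by
  have h : ∀ r : ℝ, 0 ≤ crossCov x s s u u * (r * r) + 2 * crossCov x s t u v * r
      + crossCov x t t v v := by
    intro r
    have h0 : 0 ≤ ∫ ω, (r * ⟪x s ω, u⟫ + ⟪x t ω, v⟫) ^ 2 := integral_nonneg fun _ => sq_nonneg _
    have h1 : ∀ ω, (r * ⟪x s ω, u⟫ + ⟪x t ω, v⟫) ^ 2 = (r * r) * (⟪x s ω, u⟫ * ⟪x s ω, u⟫)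
        + (2 * r) * (⟪x s ω, u⟫ * ⟪x t ω, v⟫) + ⟪x t ω, v⟫ * ⟪x t ω, v⟫ := fun ω => by ring
    simp_rw [h1] at h0
    have i1 := hx.integrable_mul s s u u
    have i2 := hx.integrable_mul s t u v
    have i3 := hx.integrable_mul t t v v
    have h2 : ∫ ω, ((r * r) * (⟪x s ω, u⟫ * ⟪x s ω, u⟫)
        + (2 * r) * (⟪x s ω, u⟫ * ⟪x t ω, v⟫) + ⟪x t ω, v⟫ * ⟪x t ω, v⟫) =
        (r * r) * crossCov x s s u u + (2 * r) * crossCov x s t u v + crossCov x t t v v := by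
      rw [integral_add, integral_add, integral_const_mul, integral_const_mul]
      · rfl
      all_goals fun_prop
    linarith
  have := discrim_le_zero h
  rw [discrim] at this
  linarith

/-- The covariance `𝔼[(⟨x_s,u⟩⟨x_s,v⟩ - C)(⟨x_t,u⟩⟨x_t,v⟩ - C)]` as given by Isserlis' theorem. -/
def isserlisCov (x : ℤ → Ω → H) (s t : ℤ) (u v : H) : ℝ :=
  crossCov x s t u u * crossCov x s t v v + crossCov x s t u v * crossCov x s t v u

lemma isserlisCov_comm (s t : ℤ) (u v : H) : isserlisCov x s t u v = isserlisCov x t s u v := by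
  simp only [isserlisCov]
  rw [crossCov_comm s t u u, crossCov_comm s t v v, crossCov_comm s t u v, crossCov_comm s t v u]
  ring

lemma TS.IsCenteredGaussianProcess.integral_sq_sum_sub [CompleteSpace H]
    [IsProbabilityMeasure (ℙ : Measure Ω)]
    (hx : IsCenteredGaussianProcess x) (hstat : IsCovStationary x) (T : Finset ℤ) (u v : H) :
    Integrable (fun ω => (∑ t ∈ T, (⟪x t ω, u⟫ * ⟪x t ω, v⟫ - crossCov x 0 0 u v)) ^ 2) ∧
    ∫ ω, (∑ t ∈ T, (⟪x t ω, u⟫ * ⟪x t ω, v⟫ - crossCov x 0 0 u v)) ^ 2 =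
      ∑ s ∈ T, ∑ t ∈ T, isserlisCov x s t u v := by
  set C := crossCov x 0 0 u v with hC
  have i2 : ∀ t, Integrable (fun ω => ⟪x t ω, u⟫ * ⟪x t ω, v⟫) := fun t =>
    hx.integrable_mul t t u v
  have i4 := fun s t => hx.integrable_mul_four s t u v u v
  have hexp : ∀ ω, (∑ t ∈ T, (⟪x t ω, u⟫ * ⟪x t ω, v⟫ - C)) ^ 2 =
      ∑ s ∈ T, ∑ t ∈ T, (⟪x s ω, u⟫ * ⟪x s ω, v⟫ * ⟪x t ω, u⟫ * ⟪x t ω, v⟫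
        - C * (⟪x s ω, u⟫ * ⟪x s ω, v⟫) - C * (⟪x t ω, u⟫ * ⟪x t ω, v⟫) + C ^ 2) := by
    intro ω
    rw [sq, Finset.sum_mul_sum]
    exact Finset.sum_congr rfl fun s _ => Finset.sum_congr rfl fun t _ => by ring
  have hi : ∀ s t, Integrable (fun ω => ⟪x s ω, u⟫ * ⟪x s ω, v⟫ * ⟪x t ω, u⟫ * ⟪x t ω, v⟫
        - C * (⟪x s ω, u⟫ * ⟪x s ω, v⟫) - C * (⟪x t ω, u⟫ * ⟪x t ω, v⟫) + C ^ 2) := fun s t =>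
    (((i4 s t).sub ((i2 s).const_mul C)).sub ((i2 t).const_mul C)).add (integrable_const _)
  simp_rw [hexp]
  refine ⟨integrable_finsetSum _ fun s _ => integrable_finsetSum _ fun t _ => hi s t, ?_⟩
  rw [integral_finsetSum _ fun s _ => integrable_finsetSum _ fun t _ => hi s t]
  refine Finset.sum_congr rfl fun s _ => ?_
  rw [integral_finsetSum _ fun t _ => hi s t]
  refine Finset.sum_congr rfl fun t _ => ?_
  have := i4 s t
  rw [integral_add, integral_sub, integral_sub, integral_const_mul, integral_const_mul,
    hx.integral_mul_four, integral_const, probReal_univ, one_smul, isserlisCov]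
  · change crossCov x s s u v * crossCov x t t u v + _ + _ - C * crossCov x s s u v
      - C * crossCov x t t u v + C ^ 2 = _
    rw [hstat.crossCov_self s, hstat.crossCov_self t, ← hC]
    ring
  all_goals fun_prop

/-- The termwise bound on `isserlisCov` by the singular value data of the cross-covariance. -/
lemma TS.IsCenteredGaussianProcess.ofReal_isserlisCov_le [CompleteSpace H]
    (hx : IsCenteredGaussianProcess x) (hstat : IsCovStationary x)
    {σ : ℕ → ℝ} {f g : ℕ → H} (hσ0 : ∀ i, 0 ≤ σ i) (hσ : Summable σ)
    (hf : ∀ i, ‖f i‖ = 1) (hg : ∀ i, ‖g i‖ = 1) {s t : ℤ}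
    (hcov : ∀ u v, crossCov x s t u v = ∑' i, σ i * ⟪f i, u⟫ * ⟪g i, v⟫) (u v : H) :
    ENNReal.ofReal (2 * isserlisCov x s t u v) ≤ ∑' i, ENNReal.ofReal (σ i *
      (crossCov x 0 0 u u * (⟪f i, v⟫ ^ 2 + 2 * ⟪g i, v⟫ ^ 2)
        + crossCov x 0 0 v v * ⟪f i, u⟫ ^ 2)) := by
  have hinner : ∀ (a w : H), ‖a‖ = 1 → |⟪a, w⟫| ≤ ‖w‖ := fun a w ha => by
    simpa [ha] using abs_real_inner_le_norm a w
  have hsq : ∀ (a w : H), ‖a‖ = 1 → ⟪a, w⟫ ^ 2 ≤ ‖w‖ ^ 2 := fun a w ha =>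
    sq_le_sq.2 (by simpa using hinner a w ha)
  have hsum : ∀ u v, HasSum (fun i => σ i * ⟪f i, u⟫ * ⟪g i, v⟫) (crossCov x s t u v) := by
    intro u v
    rw [hcov]
    refine (Summable.of_norm_bounded (hσ.mul_right (‖u‖ * ‖v‖)) fun i => ?_).hasSum
    rw [mul_assoc, norm_mul, norm_mul, Real.norm_of_nonneg (hσ0 i)]
    exact mul_le_mul_of_nonneg_left (mul_le_mul (hinner _ _ (hf i)) (hinner _ _ (hg i))
      (norm_nonneg _) (norm_nonneg _)) (hσ0 i)
  have hC0 : ∀ w, 0 ≤ crossCov x 0 0 w w := crossCov_self_nonneg 0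
  have hCS : ∀ u v, crossCov x s t u v ^ 2 ≤ crossCov x 0 0 u u * crossCov x 0 0 v v := by
    intro u v
    have := hx.crossCov_sq_le s t u v
    rwa [hstat.crossCov_self s, hstat.crossCov_self t] at this
  have hF0 : ∀ i, 0 ≤ σ i * (crossCov x 0 0 u u * (⟪f i, v⟫ ^ 2 + 2 * ⟪g i, v⟫ ^ 2)
        + crossCov x 0 0 v v * ⟪f i, u⟫ ^ 2) := fun i => by
    have := hσ0 i; have := hC0 u; have := hC0 v; positivity
  have hF : Summable fun i => σ i * (crossCov x 0 0 u u * (⟪f i, v⟫ ^ 2 + 2 * ⟪g i, v⟫ ^ 2)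
        + crossCov x 0 0 v v * ⟪f i, u⟫ ^ 2) := by
    refine Summable.of_nonneg_of_le hF0 (fun i => ?_) (hσ.mul_right
      (crossCov x 0 0 u u * (‖v‖ ^ 2 + 2 * ‖v‖ ^ 2) + crossCov x 0 0 v v * ‖u‖ ^ 2))
    exact mul_le_mul_of_nonneg_left (add_le_add
      (mul_le_mul_of_nonneg_left (add_le_add (hsq _ _ (hf i))
        (mul_le_mul_of_nonneg_left (hsq _ _ (hg i)) zero_le_two)) (hC0 u))
      (mul_le_mul_of_nonneg_left (hsq _ _ (hf i)) (hC0 v))) (hσ0 i)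
  rw [← ENNReal.ofReal_tsum_of_nonneg hF0 hF]
  refine ENNReal.ofReal_le_ofReal ?_
  have h1 := ((hsum v v).mul_left (2 * crossCov x s t u u)).add
    ((hsum u v).mul_left (2 * crossCov x s t v u))
  have h2 : 2 * isserlisCov x s t u v = 2 * crossCov x s t u u * crossCov x s t v v
      + 2 * crossCov x s t v u * crossCov x s t u v := by
    rw [isserlisCov]; ring
  rw [h2]
  refine hasSum_le (fun i => ?_) h1 hF.hasSum
  have k1 := two_mul_mul_mul_le_of_sq_le (hC0 u) (hC0 u) (hCS u u) ⟪f i, v⟫ ⟪g i, v⟫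
  have k2 := two_mul_mul_mul_le_of_sq_le (hC0 v) (hC0 u) (hCS v u) ⟪f i, u⟫ ⟪g i, v⟫
  have k3 := mul_le_mul_of_nonneg_left (add_le_add k1 k2) (hσ0 i)
  linarith

/-- `𝔼‖x_0‖²`, as the trace of the covariance in the basis `b`. -/
def covTrace {ι : Type*} (b : HilbertBasis ι ℝ H) (x : ℤ → Ω → H) : ℝ≥0∞ :=
  ∑' k, ENNReal.ofReal (crossCov x 0 0 (b k) (b k))

lemma tsum_ofReal_singular_bound {ι : Type*} (b : HilbertBasis ι ℝ H)
    {σ : ℕ → ℝ} {f g : ℕ → H} (hσ0 : ∀ i, 0 ≤ σ i)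
    (hf : ∀ i, ‖f i‖ = 1) (hg : ∀ i, ‖g i‖ = 1) :
    ∑' k, ∑' l, ∑' i, ENNReal.ofReal (σ i *
      (crossCov x 0 0 (b k) (b k) * (⟪f i, b l⟫ ^ 2 + 2 * ⟪g i, b l⟫ ^ 2)
        + crossCov x 0 0 (b l) (b l) * ⟪f i, b k⟫ ^ 2)) =
      4 * covTrace b x * ∑' i, ENNReal.ofReal (σ i) := by
  have hC0 : ∀ w, 0 ≤ crossCov x 0 0 w w := crossCov_self_nonneg 0
  have hone : ∀ a : H, ‖a‖ = 1 → ∑' k, ENNReal.ofReal (⟪a, b k⟫ ^ 2) = 1 := fun a ha => by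
    rw [b.tsum_ofReal_inner_sq, ha]; simp
  have hterm : ∀ k l i, ENNReal.ofReal (σ i *
      (crossCov x 0 0 (b k) (b k) * (⟪f i, b l⟫ ^ 2 + 2 * ⟪g i, b l⟫ ^ 2)
        + crossCov x 0 0 (b l) (b l) * ⟪f i, b k⟫ ^ 2)) =
      ENNReal.ofReal (σ i) * (ENNReal.ofReal (crossCov x 0 0 (b k) (b k)) *
        (ENNReal.ofReal (⟪f i, b l⟫ ^ 2) + 2 * ENNReal.ofReal (⟪g i, b l⟫ ^ 2))
        + ENNReal.ofReal (crossCov x 0 0 (b l) (b l)) * ENNReal.ofReal (⟪f i, b k⟫ ^ 2)) := by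
    intro k l i
    have h1 := hC0 (b k); have h2 := hC0 (b l)
    rw [ENNReal.ofReal_mul (hσ0 i), ENNReal.ofReal_add (by positivity) (by positivity),
      ENNReal.ofReal_mul h1, ENNReal.ofReal_mul h2, ENNReal.ofReal_add (by positivity)
      (by positivity), ENNReal.ofReal_mul (by norm_num), ENNReal.ofReal_ofNat]
  simp_rw [hterm]
  have hswap : ∀ F : ι → ι → ℕ → ℝ≥0∞, ∑' k, ∑' l, ∑' i, F k l i = ∑' i, ∑' k, ∑' l, F k l i := by
    intro F
    rw [ENNReal.tsum_comm (f := fun i k => ∑' l, F k l i)]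
    exact tsum_congr fun k => ENNReal.tsum_comm
  rw [hswap, ← ENNReal.tsum_mul_left]
  refine tsum_congr fun i => ?_
  simp_rw [ENNReal.tsum_mul_left, ENNReal.tsum_add, ENNReal.tsum_mul_left, ENNReal.tsum_add,
    ENNReal.tsum_mul_left, ENNReal.tsum_mul_right]
  rw [hone _ (hf i), hone _ (hg i), ENNReal.tsum_mul_left, hone _ (hf i)]
  simp only [covTrace]
  ring

/-- The trace of the covariance is at most the sum of its singular values. -/
lemma covTrace_le_tsum {ι : Type*} (b : HilbertBasis ι ℝ H) {σ : ℕ → ℝ} {f g : ℕ → H} (hσ0 : ∀ i, 0 ≤ σ i) (hσ : Summable σ)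
    (hf : ∀ i, ‖f i‖ = 1) (hg : ∀ i, ‖g i‖ = 1)
    (hcov : ∀ u v, crossCov x 0 0 u v = ∑' i, σ i * ⟪f i, u⟫ * ⟪g i, v⟫) :
    covTrace b x ≤ ∑' i, ENNReal.ofReal (σ i) := by
  have hone : ∀ a : H, ‖a‖ = 1 → ∑' k, ENNReal.ofReal (⟪a, b k⟫ ^ 2) = 1 := fun a ha => by
    rw [b.tsum_ofReal_inner_sq, ha]; simp
  have hsq : ∀ (a w : H), ‖a‖ = 1 → ⟪a, w⟫ ^ 2 ≤ ‖w‖ ^ 2 := fun a w ha =>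
    sq_le_sq.2 (by simpa [ha] using abs_real_inner_le_norm a w)
  have hterm : ∀ k, 2 * ENNReal.ofReal (crossCov x 0 0 (b k) (b k)) ≤
      ∑' i, ENNReal.ofReal (σ i) *
        (ENNReal.ofReal (⟪f i, b k⟫ ^ 2) + ENNReal.ofReal (⟪g i, b k⟫ ^ 2)) := by
    intro k
    have hF0 : ∀ i, 0 ≤ σ i * (⟪f i, b k⟫ ^ 2 + ⟪g i, b k⟫ ^ 2) := fun i => by
      have := hσ0 i; positivity
    have hF : Summable fun i => σ i * (⟪f i, b k⟫ ^ 2 + ⟪g i, b k⟫ ^ 2) :=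
      Summable.of_nonneg_of_le hF0 (fun i => mul_le_mul_of_nonneg_left
        (add_le_add (hsq _ _ (hf i)) (hsq _ _ (hg i))) (hσ0 i)) (hσ.mul_right _)
    have hle : ∀ i, |2 * (σ i * ⟪f i, b k⟫ * ⟪g i, b k⟫)| ≤
        σ i * (⟪f i, b k⟫ ^ 2 + ⟪g i, b k⟫ ^ 2) := by
      intro i
      rw [abs_le]
      constructor <;> nlinarith [hσ0 i, mul_nonneg (hσ0 i) (sq_nonneg (⟪f i, b k⟫ - ⟪g i, b k⟫)),
        mul_nonneg (hσ0 i) (sq_nonneg (⟪f i, b k⟫ + ⟪g i, b k⟫))]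
    have hs : Summable fun i => 2 * (σ i * ⟪f i, b k⟫ * ⟪g i, b k⟫) :=
      Summable.of_norm_bounded hF hle
    have h1 : 2 * crossCov x 0 0 (b k) (b k) ≤ ∑' i, σ i * (⟪f i, b k⟫ ^ 2 + ⟪g i, b k⟫ ^ 2) := by
      rw [hcov, ← tsum_mul_left]
      exact hs.tsum_le_tsum (fun i => (le_abs_self _).trans (hle i)) hF
    calc 2 * ENNReal.ofReal (crossCov x 0 0 (b k) (b k))
        = ENNReal.ofReal (2 * crossCov x 0 0 (b k) (b k)) := by
          rw [ENNReal.ofReal_mul (by norm_num), ENNReal.ofReal_ofNat]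
      _ ≤ ENNReal.ofReal (∑' i, σ i * (⟪f i, b k⟫ ^ 2 + ⟪g i, b k⟫ ^ 2)) :=
          ENNReal.ofReal_le_ofReal h1
      _ = _ := by
          rw [ENNReal.ofReal_tsum_of_nonneg hF0 hF]
          refine tsum_congr fun i => ?_
          rw [ENNReal.ofReal_mul (hσ0 i), ENNReal.ofReal_add (sq_nonneg _) (sq_nonneg _)]
  have h2 : 2 * covTrace b x ≤ 2 * ∑' i, ENNReal.ofReal (σ i) := by
    rw [covTrace, ← ENNReal.tsum_mul_left]
    refine (ENNReal.tsum_le_tsum hterm).trans (le_of_eq ?_)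
    rw [ENNReal.tsum_comm, ← ENNReal.tsum_mul_left]
    refine tsum_congr fun i => ?_
    rw [ENNReal.tsum_mul_left, ENNReal.tsum_add, hone _ (hf i), hone _ (hg i)]
    ring
  exact (ENNReal.mul_le_mul_iff_right (by simp) (by simp)).1 h2

end GaussianProcess

lemma ENNReal.ofReal_finsetSum_le {α : Type*} (s : Finset α) (F : α → ℝ) :
    ENNReal.ofReal (∑ a ∈ s, F a) ≤ ∑ a ∈ s, ENNReal.ofReal (F a) := by
  classical
  induction s using Finset.induction_on with
  | empty => simp
  | insert a s ha ih =>
    rw [Finset.sum_insert ha, Finset.sum_insert ha]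
    exact ENNReal.ofReal_add_le.trans (by gcongr)

lemma inner_hatSigFun {H : Type*} [NormedAddCommGroup H] [InnerProductSpace ℝ H]
    {Ω : Type*} {x : ℤ → Ω → H} (n : ℕ) (ω : Ω) (u v : H) :
    ⟪hatSigFun n x ω u, v⟫ =
      (1 / (n : ℝ)) * ∑ t ∈ Finset.Icc (1 : ℤ) n, ⟪x t ω, u⟫ * ⟪x t ω, v⟫ := by
  rw [hatSigFun, real_inner_smul_left, sum_inner]
  simp_rw [real_inner_smul_left]

section NormMoments

variable {H : Type*} [NormedAddCommGroup H] [InnerProductSpace ℝ H] [CompleteSpace H]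
variable {Ω : Type*} [MeasureSpace Ω] {x : ℤ → Ω → H}

lemma TS.IsCenteredGaussianProcess.aemeasurable_inner (hx : IsCenteredGaussianProcess x)
    (t : ℤ) (u : H) : AEMeasurable (fun ω => ⟪x t ω, u⟫) ℙ :=
  (hx.memLp_inner t u (p := 2) (by simp)).1.aemeasurable

lemma TS.IsCenteredGaussianProcess.aemeasurable_ofReal_norm_sq {ι : Type*} [Countable ι]
    (b : HilbertBasis ι ℝ H) (hx : IsCenteredGaussianProcess x) (t : ℤ) :
    AEMeasurable (fun ω => ENNReal.ofReal (‖x t ω‖ ^ 2)) ℙ := by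
  simp_rw [← b.tsum_ofReal_inner_sq]
  exact AEMeasurable.tsum fun k => ((hx.aemeasurable_inner t (b k)).pow_const 2).ennreal_ofReal

lemma TS.IsCenteredGaussianProcess.lintegral_ofReal_norm_sq {ι : Type*} [Countable ι]
    (b : HilbertBasis ι ℝ H) (hx : IsCenteredGaussianProcess x) (hstat : IsCovStationary x) (t : ℤ) :
    ∫⁻ ω, ENNReal.ofReal (‖x t ω‖ ^ 2) = covTrace b x := by
  simp_rw [← b.tsum_ofReal_inner_sq]
  rw [lintegral_tsum fun k => ((hx.aemeasurable_inner t (b k)).pow_const 2).ennreal_ofReal]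
  refine tsum_congr fun k => ?_
  have i := hx.integrable_mul t t (b k) (b k)
  simp_rw [← sq] at i
  rw [← ofReal_integral_eq_lintegral_ofReal i (Filter.Eventually.of_forall fun _ => sq_nonneg _),
    ← hstat.crossCov_self t, crossCov]
  simp_rw [sq]

lemma TS.IsCenteredGaussianProcess.lintegral_ofReal_norm_sq_mul_le {ι : Type*} [Countable ι]
    [IsProbabilityMeasure (ℙ : Measure Ω)] (b : HilbertBasis ι ℝ H)
    (hx : IsCenteredGaussianProcess x) (hstat : IsCovStationary x) (s t : ℤ) :
    ∫⁻ ω, ENNReal.ofReal (‖x s ω‖ ^ 2) * ENNReal.ofReal (‖x t ω‖ ^ 2) ≤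
      3 * covTrace b x ^ 2 := by
  have hm : ∀ t k, AEMeasurable (fun ω => ENNReal.ofReal (⟪x t ω, b k⟫ ^ 2)) ℙ := fun t k =>
    ((hx.aemeasurable_inner t (b k)).pow_const 2).ennreal_ofReal
  have hexp : ∀ ω, ENNReal.ofReal (‖x s ω‖ ^ 2) * ENNReal.ofReal (‖x t ω‖ ^ 2) =
      ∑' k, ∑' l, ENNReal.ofReal (⟪x s ω, b k⟫ ^ 2) * ENNReal.ofReal (⟪x t ω, b l⟫ ^ 2) := by
    intro ω
    rw [← b.tsum_ofReal_inner_sq, ← b.tsum_ofReal_inner_sq, ← ENNReal.tsum_mul_right]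
    exact tsum_congr fun k => ENNReal.tsum_mul_left.symm
  simp_rw [hexp]
  have hmm : ∀ k l, AEMeasurable (fun ω => ENNReal.ofReal (⟪x s ω, b k⟫ ^ 2) *
      ENNReal.ofReal (⟪x t ω, b l⟫ ^ 2)) ℙ := fun k l => (hm s k).mul (hm t l)
  rw [lintegral_tsum fun k => AEMeasurable.tsum fun l => hmm k l]
  simp_rw [lintegral_tsum fun l => hmm _ l]
  have hbound : 3 * covTrace b x ^ 2 = ∑' k, ∑' l, 3 *
      (ENNReal.ofReal (crossCov x 0 0 (b k) (b k)) *
        ENNReal.ofReal (crossCov x 0 0 (b l) (b l))) := by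
    simp_rw [ENNReal.tsum_mul_left, ENNReal.tsum_mul_right]
    rw [sq, covTrace]
  rw [hbound]
  refine ENNReal.tsum_le_tsum fun k => ENNReal.tsum_le_tsum fun l => ?_
  have hk := crossCov_self_nonneg (x := x) 0 (b k)
  have hl := crossCov_self_nonneg (x := x) 0 (b l)
  have hre : ∀ ω, ENNReal.ofReal (⟪x s ω, b k⟫ ^ 2) * ENNReal.ofReal (⟪x t ω, b l⟫ ^ 2) =
      ENNReal.ofReal (⟪x s ω, b k⟫ * ⟪x s ω, b k⟫ * ⟪x t ω, b l⟫ * ⟪x t ω, b l⟫) := by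
    intro ω
    rw [← ENNReal.ofReal_mul (sq_nonneg _)]
    congr 1; ring
  simp_rw [hre]
  rw [← ofReal_integral_eq_lintegral_ofReal (hx.integrable_mul_four s t _ _ _ _)
      (Filter.Eventually.of_forall fun ω => by
        change 0 ≤ ⟪x s ω, b k⟫ * ⟪x s ω, b k⟫ * ⟪x t ω, b l⟫ * ⟪x t ω, b l⟫
        rw [mul_assoc]
        exact mul_nonneg (mul_self_nonneg _) (mul_self_nonneg _)),
    hx.integral_mul_four, ← ENNReal.ofReal_mul hk,
    show (3 : ℝ≥0∞) = ENNReal.ofReal 3 by simp, ← ENNReal.ofReal_mul (by norm_num)]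
  refine ENNReal.ofReal_le_ofReal ?_
  have h := hx.crossCov_sq_le s t (b k) (b l)
  rw [hstat.crossCov_self s, hstat.crossCov_self t] at h ⊢
  linarith

/-- `√(𝔼‖X‖²_HS) ≤ 2 𝔼‖X‖_HS`. -/
lemma TS.IsCenteredGaussianProcess.sqrt_le_two_mul_integral_hsNorm {ι : Type*} [Countable ι]
    [IsProbabilityMeasure (ℙ : Measure Ω)] (b : HilbertBasis ι ℝ H)
    (hx : IsCenteredGaussianProcess x) (hstat : IsCovStationary x) (n : ℕ) {τ : ℝ} (hτ0 : 0 ≤ τ)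
    (hτ : covTrace b x = ENNReal.ofReal τ) :
    √(n * τ) ≤ 2 * ∫ ω, hsNorm n x ω := by
  have hm := hx.aemeasurable_ofReal_norm_sq (b := b)
  have hR : ∀ ω, ENNReal.ofReal (∑ t ∈ Finset.Icc (1 : ℤ) n, ‖x t ω‖ ^ 2) =
      ∑ t ∈ Finset.Icc (1 : ℤ) n, ENNReal.ofReal (‖x t ω‖ ^ 2) := fun ω =>
    ENNReal.ofReal_sum_of_nonneg fun _ _ => sq_nonneg _
  have hR0 : ∀ ω, 0 ≤ ∑ t ∈ Finset.Icc (1 : ℤ) n, ‖x t ω‖ ^ 2 := fun ω =>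
    Finset.sum_nonneg fun _ _ => sq_nonneg _
  have hmR : AEMeasurable (fun ω => ∑ t ∈ Finset.Icc (1 : ℤ) n,
      ENNReal.ofReal (‖x t ω‖ ^ 2)) (ℙ : Measure Ω) :=
    Finset.aemeasurable_fun_sum _ fun t _ => hm t
  refine sqrt_le_two_mul_integral_sqrt (by positivity) hR0 ?_ ?_ ?_
  · refine hmR.ennreal_toReal.congr (Filter.Eventually.of_forall fun ω => ?_)
    simp only
    rw [← hR, ENNReal.toReal_ofReal (hR0 ω)]
  · simp_rw [hR]
    rw [lintegral_finsetSum' _ fun t _ => hm t]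
    simp_rw [hx.lintegral_ofReal_norm_sq (b := b) hstat, hτ]
    rw [ENNReal.ofReal_mul (by positivity), Finset.sum_const, Int.card_Icc]
    simp
  · have hexp : ∀ ω, ENNReal.ofReal ((∑ t ∈ Finset.Icc (1 : ℤ) n, ‖x t ω‖ ^ 2) ^ 2) =
        ∑ s ∈ Finset.Icc (1 : ℤ) n, ∑ t ∈ Finset.Icc (1 : ℤ) n,
          ENNReal.ofReal (‖x s ω‖ ^ 2) * ENNReal.ofReal (‖x t ω‖ ^ 2) := fun ω => by
      rw [sq, ENNReal.ofReal_mul (hR0 ω), hR, Finset.sum_mul_sum]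
    simp_rw [hexp]
    have hmm : ∀ s t, AEMeasurable (fun ω => ENNReal.ofReal (‖x s ω‖ ^ 2) *
        ENNReal.ofReal (‖x t ω‖ ^ 2)) ℙ := fun s t => (hm s).mul (hm t)
    rw [lintegral_finsetSum' _ fun s _ => Finset.aemeasurable_fun_sum _ fun t _ => hmm s t]
    simp_rw [lintegral_finsetSum' _ fun t _ => hmm _ t]
    refine (Finset.sum_le_sum fun s _ => Finset.sum_le_sum fun t _ =>
      hx.lintegral_ofReal_norm_sq_mul_le (b := b) hstat s t).trans (le_of_eq ?_)
    rw [hτ, Finset.sum_const, Finset.sum_const, Int.card_Icc, ENNReal.ofReal_mul (by norm_num),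
      ENNReal.ofReal_pow (by positivity), ENNReal.ofReal_mul (by positivity)]
    simp
    ring

end NormMoments

section EmpiricalCovariance

variable {H : Type*} [NormedAddCommGroup H] [InnerProductSpace ℝ H] [CompleteSpace H]

lemma inner_sig0Fun {σ : ℤ → ℕ → ℝ} {f g : ℤ → ℕ → H} (hσ0 : ∀ i, 0 ≤ σ 0 i)
    (hσ : Summable (σ 0)) (hf : ∀ i, ‖f 0 i‖ = 1) (hg : ∀ i, ‖g 0 i‖ = 1) (u v : H) :
    ⟪Sig0Fun σ f g u, v⟫ = ∑' i, σ 0 i * ⟪f 0 i, u⟫ * ⟪g 0 i, v⟫ := by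
  have hs : Summable fun i => (σ 0 i * ⟪f 0 i, u⟫) • g 0 i := by
    refine Summable.of_norm_bounded (hσ.mul_right ‖u‖) fun i => ?_
    rw [norm_smul, hg, mul_one, norm_mul, Real.norm_of_nonneg (hσ0 i)]
    refine mul_le_mul_of_nonneg_left ?_ (hσ0 i)
    simpa [hf i] using abs_real_inner_le_norm (f 0 i) u
  have h := hs.hasSum.mapL (innerSL ℝ v)
  simp only [innerSL_apply_apply, real_inner_smul_right] at h
  rw [real_inner_comm, Sig0Fun, ← h.tsum_eq]
  exact tsum_congr fun i => by rw [real_inner_comm v]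

/-- The expected squared Hilbert–Schmidt error of the empirical covariance, where `S h` is the
trace norm of the lag-`h` cross-covariance operator. -/
lemma TS.IsCenteredGaussianProcess.lintegral_hilbertSchmidt_le {Ω : Type*} [MeasureSpace Ω]
    [IsProbabilityMeasure (ℙ : Measure Ω)] {x : ℤ → Ω → H} {ι : Type*} [Countable ι]
    (b : HilbertBasis ι ℝ H) (hx : IsCenteredGaussianProcess x) (hstat : IsCovStationary x)
    {n : ℕ} (hn : 0 < n) {σ : ℤ → ℕ → ℝ} {f g : ℤ → ℕ → H}
    (hσ0 : ∀ h i, 0 ≤ σ h i) (hσ : ∀ h, Summable (σ h))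
    (hf : ∀ h i, ‖f h i‖ = 1) (hg : ∀ h i, ‖g h i‖ = 1)
    (hcov : ∀ h u v, crossCov x h 0 u v = ∑' i, σ h i * ⟪f h i, u⟫ * ⟪g h i, v⟫)
    {τ : ℝ} (hτ0 : 0 ≤ τ) (hτ : covTrace b x = ENNReal.ofReal τ) :
    ∫⁻ ω, ∑' k, ∑' l, ENNReal.ofReal
        (((1 / (n : ℝ)) * ∑ t ∈ Finset.Icc (1 : ℤ) n, ⟪x t ω, b k⟫ * ⟪x t ω, b l⟫
          - crossCov x 0 0 (b k) (b l)) ^ 2) ≤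
      ENNReal.ofReal (2 * τ / n * trSigBar σ n) := by
  have hn' : (0 : ℝ) < n := by exact_mod_cast hn
  have hpair : ∀ s t k l, ENNReal.ofReal (2 * isserlisCov x s t (b k) (b l)) ≤
      ∑' i, ENNReal.ofReal (σ (s - t).natAbs i *
      (crossCov x 0 0 (b k) (b k) *
        (⟪f (s - t).natAbs i, b l⟫ ^ 2 + 2 * ⟪g (s - t).natAbs i, b l⟫ ^ 2)
        + crossCov x 0 0 (b l) (b l) * ⟪f (s - t).natAbs i, b k⟫ ^ 2)) := by
    intro s t k l
    wlog hst : t ≤ s generalizing s t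
    · have := this t s (by omega)
      rwa [isserlisCov_comm, show (t - s).natAbs = (s - t).natAbs by omega] at this
    have hh : ((s - t).natAbs : ℤ) = s - t := by omega
    refine hx.ofReal_isserlisCov_le hstat (hσ0 _) (hσ _) (hf _) (hg _) (fun u v => ?_) _ _
    rw [← hcov, hh]
    have := hstat t (s - t) u v
    rw [add_sub_cancel] at this
    exact this
  have hrow : ∀ s t, ∑' k, ∑' l, ENNReal.ofReal (2 * isserlisCov x s t (b k) (b l)) ≤
      ENNReal.ofReal (4 * τ * ∑' i, σ (s - t).natAbs i) := by
    intro s t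
    refine (ENNReal.tsum_le_tsum fun k => ENNReal.tsum_le_tsum fun l => hpair s t k l).trans
      (le_of_eq ?_)
    rw [tsum_ofReal_singular_bound b (hσ0 _) (hf _) (hg _), hτ,
      ← ENNReal.ofReal_tsum_of_nonneg (hσ0 _) (hσ _), ENNReal.ofReal_mul (by positivity),
      ENNReal.ofReal_mul (by norm_num), ENNReal.ofReal_ofNat]
  have hsq : ∀ k l ω, ((1 / (n : ℝ)) * ∑ t ∈ Finset.Icc (1 : ℤ) n, ⟪x t ω, b k⟫ * ⟪x t ω, b l⟫
      - crossCov x 0 0 (b k) (b l)) ^ 2 = (1 / (n : ℝ) ^ 2) * (∑ t ∈ Finset.Icc (1 : ℤ) n,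
        (⟪x t ω, b k⟫ * ⟪x t ω, b l⟫ - crossCov x 0 0 (b k) (b l))) ^ 2 := by
    intro k l ω
    rw [Finset.sum_sub_distrib, Finset.sum_const, Int.card_Icc]
    simp only [add_sub_cancel_right, Int.toNat_natCast, nsmul_eq_mul]
    field_simp
  have hI : ∀ k l, Integrable (fun ω => (1 / (n : ℝ) ^ 2) * (∑ t ∈ Finset.Icc (1 : ℤ) n,
        (⟪x t ω, b k⟫ * ⟪x t ω, b l⟫ - crossCov x 0 0 (b k) (b l))) ^ 2) := fun k l =>
    (hx.integral_sq_sum_sub hstat _ _ _).1.const_mul _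
  have hterm : ∀ k l, ∫⁻ ω, ENNReal.ofReal ((1 / (n : ℝ) ^ 2) * (∑ t ∈ Finset.Icc (1 : ℤ) n,
        (⟪x t ω, b k⟫ * ⟪x t ω, b l⟫ - crossCov x 0 0 (b k) (b l))) ^ 2) ≤
      ENNReal.ofReal (1 / (2 * (n : ℝ) ^ 2)) * ∑ s ∈ Finset.Icc (1 : ℤ) n,
        ∑ t ∈ Finset.Icc (1 : ℤ) n, ENNReal.ofReal (2 * isserlisCov x s t (b k) (b l)) := by
    intro k l
    rw [← ofReal_integral_eq_lintegral_ofReal (hI k l)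
      (Filter.Eventually.of_forall fun ω => by positivity), integral_const_mul,
      (hx.integral_sq_sum_sub hstat _ _ _).2]
    have : 1 / (n : ℝ) ^ 2 * ∑ s ∈ Finset.Icc (1 : ℤ) n, ∑ t ∈ Finset.Icc (1 : ℤ) n,
        isserlisCov x s t (b k) (b l) = 1 / (2 * (n : ℝ) ^ 2) * ∑ s ∈ Finset.Icc (1 : ℤ) n,
          ∑ t ∈ Finset.Icc (1 : ℤ) n, 2 * isserlisCov x s t (b k) (b l) := by
      simp_rw [← Finset.mul_sum]
      field_simp
    rw [this, ENNReal.ofReal_mul (by positivity)]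
    gcongr
    exact (ENNReal.ofReal_finsetSum_le _ _).trans
      (Finset.sum_le_sum fun s _ => ENNReal.ofReal_finsetSum_le _ _)
  simp_rw [hsq]
  have hm := fun k l => (hI k l).1.aemeasurable.ennreal_ofReal
  rw [lintegral_tsum fun k => AEMeasurable.tsum fun l => hm k l]
  simp_rw [lintegral_tsum fun l => hm _ l]
  refine (ENNReal.tsum_le_tsum fun k => ENNReal.tsum_le_tsum fun l => hterm k l).trans ?_
  simp_rw [ENNReal.tsum_mul_left]
  have hswap : ∑' k, ∑' l, ∑ s ∈ Finset.Icc (1 : ℤ) n, ∑ t ∈ Finset.Icc (1 : ℤ) n,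
        ENNReal.ofReal (2 * isserlisCov x s t (b k) (b l)) =
      ∑ s ∈ Finset.Icc (1 : ℤ) n, ∑ t ∈ Finset.Icc (1 : ℤ) n, ∑' k, ∑' l,
        ENNReal.ofReal (2 * isserlisCov x s t (b k) (b l)) := by
    simp_rw [Summable.tsum_finsetSum fun _ _ => ENNReal.summable]
  rw [hswap]
  set S : ℕ → ℝ := fun h => ∑' i, σ h i with hS
  have hS0 : ∀ h, 0 ≤ S h := fun h => tsum_nonneg (hσ0 h)
  calc ENNReal.ofReal (1 / (2 * (n : ℝ) ^ 2)) * ∑ s ∈ Finset.Icc (1 : ℤ) n,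
        ∑ t ∈ Finset.Icc (1 : ℤ) n, ∑' k, ∑' l,
          ENNReal.ofReal (2 * isserlisCov x s t (b k) (b l))
      ≤ ENNReal.ofReal (1 / (2 * (n : ℝ) ^ 2)) * ∑ s ∈ Finset.Icc (1 : ℤ) n,
        ∑ t ∈ Finset.Icc (1 : ℤ) n, ENNReal.ofReal (4 * τ * S (s - t).natAbs) := by
        gcongr with s _ t _
        exact hrow s t
    _ = ENNReal.ofReal (1 / (2 * (n : ℝ) ^ 2) * ∑ s ∈ Finset.Icc (1 : ℤ) n,
        ∑ t ∈ Finset.Icc (1 : ℤ) n, 4 * τ * S (s - t).natAbs) := by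
        have h0 : ∀ s t : ℤ, 0 ≤ 4 * τ * S (s - t).natAbs := fun s t =>
          mul_nonneg (by positivity) (hS0 _)
        rw [ENNReal.ofReal_mul (by positivity), ENNReal.ofReal_sum_of_nonneg fun s _ =>
          Finset.sum_nonneg fun t _ => h0 s t]
        simp_rw [ENNReal.ofReal_sum_of_nonneg fun t _ => h0 _ t]
    _ ≤ _ := by
        refine ENNReal.ofReal_le_ofReal ?_
        have h1 : ∑ s ∈ Finset.Icc (1 : ℤ) n, ∑ t ∈ Finset.Icc (1 : ℤ) n, S (s - t).natAbs ≤
            ∑ _s ∈ Finset.Icc (1 : ℤ) n, trSigBar σ n :=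
          Finset.sum_le_sum fun s hs => by
            simpa [hS, trSigBar, trSig0] using sum_natAbs_sub_le hS0 n hs
        rw [Finset.sum_const, Int.card_Icc] at h1
        simp only [add_sub_cancel_right, Int.toNat_natCast, nsmul_eq_mul] at h1
        simp_rw [← Finset.mul_sum]
        calc 1 / (2 * (n : ℝ) ^ 2) * (4 * τ * ∑ s ∈ Finset.Icc (1 : ℤ) n,
              ∑ t ∈ Finset.Icc (1 : ℤ) n, S (s - t).natAbs)
            ≤ 1 / (2 * (n : ℝ) ^ 2) * (4 * τ * (n * trSigBar σ n)) := by gcongr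
          _ = 2 * τ / n * trSigBar σ n := by field_simp; norm_num

end EmpiricalCovariance
/-- Lemma D.1: decoupling / Sudakov–Fernique step of the moment bound:
`𝔼‖Σ̂₀ − Σ₀‖ ≤ (2√2/n) 𝔼‖X‖_HS (√(tr Σ̄_n) + √(‖Σ̄_n‖))`. -/
theorem stmt10
    (H : Type*) [NormedAddCommGroup H] [InnerProductSpace ℝ H] [CompleteSpace H]
    [TopologicalSpace.SeparableSpace H]
    (Ω : Type*) [MeasureSpace Ω] [IsProbabilityMeasure (ℙ : Measure Ω)]
    (n : ℕ) (hn : 0 < n)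
    (x : ℤ → Ω → H)
    (hgauss : IsCenteredGaussianProcess x)
    (hstat : IsCovStationary x)
    (hint : ∀ (s t : ℤ) (u v : H), Integrable (fun ω => ⟪x s ω, u⟫ * ⟪x t ω, v⟫))
    (σ : ℤ → ℕ → ℝ) (f g : ℤ → ℕ → H)
    (hσ0 : ∀ h i, 0 ≤ σ h i)
    (htrace : ∀ h : ℤ, Summable (σ h))
    (hf : ∀ h : ℤ, Orthonormal ℝ (f h)) (hg : ∀ h : ℤ, Orthonormal ℝ (g h))
    (hcov : ∀ (h : ℤ) (u v : H),
      (∫ ω, ⟪x h ω, u⟫ * ⟪x 0 ω, v⟫) = ∑' i, σ h i * ⟪f h i, u⟫ * ⟪g h i, v⟫) :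
    (∫ ω, opNormH (fun u => hatSigFun n x ω u - Sig0Fun σ f g u)) ≤
      (2 * Real.sqrt 2 / n) * (∫ ω, hsNorm n x ω) *
        (Real.sqrt (trSigBar σ n) + Real.sqrt (opNormH (SigBarFun σ f g n))) := by
  have hf1 : ∀ h i, ‖f h i‖ = 1 := fun h => (hf h).1
  have hg1 : ∀ h i, ‖g h i‖ = 1 := fun h => (hg h).1
  obtain ⟨w, b, -⟩ := exists_hilbertBasis ℝ H
  have : Countable w := b.orthonormal.countable_of_separableSpace
  have hτfin : covTrace b x ≠ ∞ := by
    refine ne_top_of_le_ne_top ?_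
      (covTrace_le_tsum b (hσ0 0) (htrace 0) (hf1 0) (hg1 0) (hcov 0))
    rw [← ENNReal.ofReal_tsum_of_nonneg (hσ0 0) (htrace 0)]
    exact ENNReal.ofReal_ne_top
  set τ := (covTrace b x).toReal with hτdef
  have hτ0 : 0 ≤ τ := ENNReal.toReal_nonneg
  have hτ : covTrace b x = ENNReal.ofReal τ := (ENNReal.ofReal_toReal hτfin).symm
  have hn' : (0 : ℝ) < n := by exact_mod_cast hn
  have hT0 : 0 ≤ trSigBar σ n := by
    have h0 : ∀ h, 0 ≤ ∑' i, σ h i := fun h => tsum_nonneg (hσ0 h)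
    exact add_nonneg (h0 0) (mul_nonneg zero_le_two (Finset.sum_nonneg fun h _ => h0 h))
  have hinner : ∀ ω u v, ⟪hatSigFun n x ω u - Sig0Fun σ f g u, v⟫ =
      (1 / (n : ℝ)) * ∑ t ∈ Finset.Icc (1 : ℤ) n, ⟪x t ω, u⟫ * ⟪x t ω, v⟫
        - crossCov x 0 0 u v := by
    intro ω u v
    rw [inner_sub_left, inner_hatSigFun, inner_sig0Fun (hσ0 0) (htrace 0) (hf1 0) (hg1 0),
      ← hcov 0 u v, crossCov]
  have hsymm : ∀ ω u v, ⟪hatSigFun n x ω u - Sig0Fun σ f g u, v⟫ =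
      ⟪u, hatSigFun n x ω v - Sig0Fun σ f g v⟫ := by
    intro ω u v
    rw [real_inner_comm _ u, hinner, hinner, crossCov_comm 0 0 u v]
    simp_rw [mul_comm]
  have hQm : AEMeasurable (fun ω => ∑' k, ∑' l, ENNReal.ofReal
      (((1 / (n : ℝ)) * ∑ t ∈ Finset.Icc (1 : ℤ) n, ⟪x t ω, b k⟫ * ⟪x t ω, b l⟫
        - crossCov x 0 0 (b k) (b l)) ^ 2)) (ℙ : Measure Ω) := by
    have hm := hgauss.aemeasurable_inner
    refine AEMeasurable.tsum fun k => AEMeasurable.tsum fun l => AEMeasurable.ennreal_ofReal ?_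
    exact (((Finset.aemeasurable_fun_sum _ fun t _ =>
      (hm t (b k)).mul (hm t (b l))).const_mul _).sub_const _).pow_const 2
  have hmain := integral_le_sqrt_of_ofReal_sq_le
    (φ := fun ω => opNormH (fun u => hatSigFun n x ω u - Sig0Fun σ f g u))
    (fun ω => Real.sSup_nonneg (by rintro r ⟨u, -, rfl⟩; exact norm_nonneg _)) (fun ω => ?_) hQm
    (hgauss.lintegral_hilbertSchmidt_le b hstat hn hσ0 htrace hf1 hg1 hcov hτ0 hτ)
  · have hR := hgauss.sqrt_le_two_mul_integral_hsNorm b hstat n hτ0 hτ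
    have hsplit : √(2 * τ / n * trSigBar σ n) = √2 / n * √(n * τ) * √(trSigBar σ n) := by
      have : 2 * τ / n * trSigBar σ n = 2 * (n * τ) * trSigBar σ n / n ^ 2 := by field_simp
      rw [this, Real.sqrt_div' _ (by positivity), Real.sqrt_sq hn'.le,
        Real.sqrt_mul (by positivity), Real.sqrt_mul (by norm_num)]
      ring
    have hI0 : 0 ≤ ∫ ω, hsNorm n x ω := integral_nonneg fun ω => Real.sqrt_nonneg _
    calc _ ≤ √(2 * τ / n * trSigBar σ n) := hmain
      _ = √2 / n * √(n * τ) * √(trSigBar σ n) := hsplit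
      _ ≤ √2 / n * (2 * ∫ ω, hsNorm n x ω) * √(trSigBar σ n) := by gcongr
      _ = (2 * √2 / n) * (∫ ω, hsNorm n x ω) * (√(trSigBar σ n) + 0) := by ring
      _ ≤ _ := by
        gcongr
        exact Real.sqrt_nonneg _
  · set Q := ∑' k, ∑' l, ENNReal.ofReal
      (((1 / (n : ℝ)) * ∑ t ∈ Finset.Icc (1 : ℤ) n, ⟪x t ω, b k⟫ * ⟪x t ω, b l⟫
        - crossCov x 0 0 (b k) (b l)) ^ 2) with hQ
    rcases eq_or_ne Q ∞ with h | h
    · rw [h]; exact le_top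
    rw [ENNReal.ofReal_le_iff_le_toReal h]
    have hle : opNormH (fun u => hatSigFun n x ω u - Sig0Fun σ f g u) ≤ √Q.toReal := by
      refine Real.sSup_le ?_ (Real.sqrt_nonneg _)
      rintro r ⟨u, hu, rfl⟩
      refine Real.le_sqrt_of_sq_le ((ENNReal.ofReal_le_iff_le_toReal h).1 ?_)
      have := b.ofReal_norm_sq_le_of_symmetric (hsymm ω) u hu
      simpa only [hinner] using this
    have h0 : 0 ≤ opNormH (fun u => hatSigFun n x ω u - Sig0Fun σ f g u) :=
      Real.sSup_nonneg (by rintro r ⟨u, -, rfl⟩; exact norm_nonneg _)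
    exact (pow_le_pow_left₀ h0 hle 2).trans_eq (Real.sq_sqrt ENNReal.toReal_nonneg)
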